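/- Let d ≥ 1 and let G be a multigraph on a finite vertex set V with |V| = n and edge set E with |E| = binom(d+1,2)(n−1) + d². Then |F| ≤ d(n_F − ω_F) + binom(d,2)·n_F + binom(d+1,2) for every nonempty subset F ⊆ E if and only if E can be partitioned into d pairwise edge-disjoint spanning trees T₁,…,T_d, binom(d,2) pairwise edge-disjoint spanning pseudo-forests, and a remaining set of binom(d+1,2) edges. (Combinatorial description of the bases of the union of d graphic matroids, binom(d,2) bicycle matroids and the uniform matroid of rank binom(d+1,2).) -/

import Mathlib

/-- The set `V_F` of vertices incident to some edge of `F`. -/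
def incVerts {V E : Type*} [DecidableEq V] (tail head : E → V) (F : Finset E) :
    Finset V :=
  F.image tail ∪ F.image head

/-- Two vertices are adjacent through `F` if some edge of `F` joins them. -/
def adjRel {V E : Type*} (tail head : E → V) (F : Finset E) (u v : V) : Prop :=
  ∃ e ∈ F, (tail e = u ∧ head e = v) ∨ (tail e = v ∧ head e = u)

/-- `ω_F`: the number of connected components of the graph `(V_F, F)`. -/
noncomputable def numComp {V E : Type*} [DecidableEq V] (tail head : E → V)
    (F : Finset E) : ℕ :=
  Nat.card (Quot fun u v : {x : V // x ∈ incVerts tail head F} =>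
    adjRel tail head F u.1 v.1)

/-- `T` is a spanning tree: `|T| = |V| − 1` and `(V, T)` is connected. -/
def IsSpanningTree {V E : Type*} [Fintype V] (tail head : E → V) (T : Finset E) : Prop :=
  T.card + 1 = Fintype.card V ∧ ∀ u v : V, Relation.EqvGen (adjRel tail head T) u v

/-- `P` is a spanning pseudo-forest: `|P| = |V|` and every nonempty `U ⊆ V` spans at most
`|U|` edges of `P`. -/
def IsSpanningPseudoForest {V E : Type*} [Fintype V] [DecidableEq V] [DecidableEq E]
    (tail head : E → V) (P : Finset E) : Prop :=
  P.card = Fintype.card V ∧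
    ∀ U : Finset V, U.Nonempty →
      (P.filter fun e => tail e ∈ U ∧ head e ∈ U).card ≤ U.card

/-! ### A Rado-type partition theorem for monotone submodular functions -/

theorem rado_step {E ι : Type*} [DecidableEq E] [Fintype ι] [DecidableEq ι]
    (f : ι → Finset E → ℤ)
    (hmono : ∀ i X Y, X ⊆ Y → f i X ≤ f i Y)
    (hsub : ∀ i X Y, f i (X ∪ Y) + f i (X ∩ Y) ≤ f i X + f i Y)
    (A : E → Finset ι)
    (hA : ∀ F : Finset E, (F.card : ℤ) ≤ ∑ i, f i (F.filter fun a => i ∈ A a))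
    (e : E) (x y : ι) (hxy : x ≠ y)
    (h1 : ∃ F : Finset E, ∑ i, f i (F.filter fun a => i ∈ Function.update A e ((A e).erase x) a)
        < (F.card : ℤ))
    (h2 : ∃ F : Finset E, ∑ i, f i (F.filter fun a => i ∈ Function.update A e ((A e).erase y) a)
        < (F.card : ℤ)) : False := by
  obtain ⟨F1, h1⟩ := h1
  obtain ⟨F2, h2⟩ := h2
  have key : ∀ (z : ι) (F : Finset E),
      ∑ i, f i (F.filter fun a => i ∈ Function.update A e ((A e).erase z) a)
        < (F.card : ℤ) → e ∈ F := by
    intro z F h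
    by_contra he
    have : ∀ i, (F.filter fun a => i ∈ Function.update A e ((A e).erase z) a)
        = F.filter fun a => i ∈ A a := by
      intro i
      apply Finset.filter_congr
      intro a ha
      have : a ≠ e := fun h => he (h ▸ ha)
      simp [Function.update_of_ne this]
    simp only [this] at h
    exact absurd (hA F) (not_le.mpr h)
  have e1 := key x F1 h1
  have e2 := key y F2 h2
  have hU := hA (F1 ∪ F2)
  have hI := hA ((F1 ∩ F2).erase e)
  have hc := Finset.card_union_add_card_inter F1 F2
  have hc2 := Finset.card_erase_add_one (Finset.mem_inter.mpr ⟨e1, e2⟩)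
  have hs : ∑ i, f i ((F1 ∪ F2).filter fun a => i ∈ A a)
      + ∑ i, f i (((F1 ∩ F2).erase e).filter fun a => i ∈ A a)
      ≤ ∑ i, f i (F1.filter fun a => i ∈ Function.update A e ((A e).erase x) a)
        + ∑ i, f i (F2.filter fun a => i ∈ Function.update A e ((A e).erase y) a) := by
    rw [← Finset.sum_add_distrib, ← Finset.sum_add_distrib]
    apply Finset.sum_le_sum
    intro i _
    refine le_trans (add_le_add (hmono i _ _ ?_) (hmono i _ _ ?_)) (hsub i _ _)
    · intro a ha
      simp only [Finset.mem_filter, Finset.mem_union] at ha ⊢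
      by_cases hae : a = e
      · subst hae
        simp only [Function.update_self, Finset.mem_erase]
        by_cases hix : i = x
        · right; exact ⟨e2, fun h => hxy (hix ▸ h), ha.2⟩
        · left; exact ⟨e1, hix, ha.2⟩
      · simp only [Function.update_of_ne hae]
        tauto
    · intro a ha
      simp only [Finset.mem_filter, Finset.mem_inter, Finset.mem_erase] at ha ⊢
      simp only [Function.update_of_ne ha.1.1]
      tauto
  have hcz : ((F1 ∪ F2).card : ℤ) + (F1 ∩ F2).card = F1.card + F2.card := by exact_mod_cast hc
  have hc2z : (((F1 ∩ F2).erase e).card : ℤ) + 1 = (F1 ∩ F2).card := by exact_mod_cast hc2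
  linarith

theorem rado_aux {E ι : Type*} [DecidableEq E] [Fintype E] [Fintype ι] [DecidableEq ι]
    (f : ι → Finset E → ℤ) (h0 : ∀ i, f i ∅ = 0)
    (hmono : ∀ i X Y, X ⊆ Y → f i X ≤ f i Y)
    (hsub : ∀ i X Y, f i (X ∪ Y) + f i (X ∩ Y) ≤ f i X + f i Y) (n : ℕ) :
    ∀ (A : E → Finset ι), ∑ e, (A e).card = n →
    (∀ F : Finset E, (F.card : ℤ) ≤ ∑ i, f i (F.filter fun a => i ∈ A a)) →
    ∃ c : E → ι, ∀ F : Finset E, (F.card : ℤ) ≤ ∑ i, f i (F.filter fun a => c a = i) := by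
  induction n using Nat.strong_induction_on with
  | _ n ih =>
    intro A hn hA
    by_cases hbig : ∃ e, 1 < (A e).card
    · obtain ⟨e, he⟩ := hbig
      obtain ⟨x, hx, y, hy, hxy⟩ := Finset.one_lt_card.mp he
      have lt : ∀ z ∈ A e, ∑ a, (Function.update A e ((A e).erase z) a).card < n := by
        intro z hz
        rw [← hn]
        apply Finset.sum_lt_sum
        · intro a _
          by_cases hae : a = e
          · subst hae
            simp only [Function.update_self]
            exact Finset.card_le_card (Finset.erase_subset _ _)
          · simp [Function.update_of_ne hae]
        · refine ⟨e, Finset.mem_univ _, ?_⟩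
          simp only [Function.update_self]
          exact Finset.card_erase_lt_of_mem hz
      by_cases h1 : ∀ F : Finset E, (F.card : ℤ) ≤
          ∑ i, f i (F.filter fun a => i ∈ Function.update A e ((A e).erase x) a)
      · exact ih _ (lt x hx) _ rfl h1
      by_cases h2 : ∀ F : Finset E, (F.card : ℤ) ≤
          ∑ i, f i (F.filter fun a => i ∈ Function.update A e ((A e).erase y) a)
      · exact ih _ (lt y hy) _ rfl h2
      exfalso
      simp only [not_forall, not_le] at h1 h2
      exact rado_step f hmono hsub A hA e x y hxy h1 h2
    · simp only [not_exists, not_lt] at hbig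
      have hone : ∀ e, ∃ i, A e = {i} := by
        intro e
        apply Finset.card_eq_one.mp
        refine le_antisymm (hbig e) ?_
        rw [Nat.one_le_iff_ne_zero]
        intro hz
        rw [Finset.card_eq_zero] at hz
        have h := hA {e}
        have hh : ∀ i, (({e} : Finset E).filter fun a => i ∈ A a) = ∅ := by
          intro i
          ext a
          simp only [Finset.mem_filter, Finset.mem_singleton, Finset.notMem_empty, iff_false]
          rintro ⟨rfl, hi⟩
          rw [hz] at hi
          exact absurd hi (Finset.notMem_empty i)
        simp only [hh, h0, Finset.sum_const_zero] at h
        simp at h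
      choose c hc using hone
      refine ⟨c, fun F => ?_⟩
      have h := hA F
      simp only [hc, Finset.mem_singleton] at h
      simpa only [eq_comm] using h

theorem rado_partition {E ι : Type*} [DecidableEq E] [Fintype E] [Fintype ι] [DecidableEq ι]
    (f : ι → Finset E → ℤ) (h0 : ∀ i, f i ∅ = 0)
    (hmono : ∀ i X Y, X ⊆ Y → f i X ≤ f i Y)
    (hsub : ∀ i X Y, f i (X ∪ Y) + f i (X ∩ Y) ≤ f i X + f i Y)
    (h : ∀ F : Finset E, (F.card : ℤ) ≤ ∑ i, f i F) :
    ∃ c : E → ι, ∀ i, ∀ F : Finset E, (∀ a ∈ F, c a = i) → (F.card : ℤ) ≤ f i F := by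
  obtain ⟨c, hc⟩ := rado_aux f h0 hmono hsub _ (fun _ => Finset.univ) rfl (by simpa using h)
  refine ⟨c, fun i F hF => (hc F).trans ?_⟩
  rw [Finset.sum_eq_single i]
  · exact hmono i _ _ (Finset.filter_subset _ _)
  · intro j _ hj
    have : (F.filter fun a => c a = j) = ∅ := by
      apply Finset.filter_false_of_mem
      intro a ha hcj
      exact hj (hcj.symm.trans (hF a ha))
    rw [this, h0]
  · simp

/-! ### Rank of a graph through functions constant on the edges -/

/-- Functions on the vertices that agree on the two endpoints of each edge of `F`. -/
def constSub {V E : Type*} (tail head : E → V) (F : Finset E) : Submodule ℚ (V → ℚ) where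
  carrier := {φ | ∀ e ∈ F, φ (tail e) = φ (head e)}
  add_mem' := by
    intro a b ha hb e he
    simp [ha e he, hb e he]
  zero_mem' := by intro e _; rfl
  smul_mem' := by
    intro c a ha e he
    simp [ha e he]

theorem mem_constSub {V E : Type*} (tail head : E → V) (F : Finset E) (φ : V → ℚ) :
    φ ∈ constSub tail head F ↔ ∀ e ∈ F, φ (tail e) = φ (head e) := Iff.rfl

/-- The graphic rank. -/
noncomputable def grk {V E : Type*} [Fintype V] (tail head : E → V) (F : Finset E) : ℤ :=
  (Fintype.card V : ℤ) - Module.finrank ℚ (constSub tail head F)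

theorem grk_empty {V E : Type*} [Fintype V] (tail head : E → V) : grk tail head ∅ = 0 := by
  have : constSub tail head ∅ = ⊤ := by
    ext φ; simp [mem_constSub]
  unfold grk
  rw [this, finrank_top, Module.finrank_fintype_fun_eq_card, sub_self]

theorem grk_mono {V E : Type*} [Fintype V] (tail head : E → V) (X Y : Finset E) (h : X ⊆ Y) :
    grk tail head X ≤ grk tail head Y := by
  have : constSub tail head Y ≤ constSub tail head X := fun φ hφ e he => hφ e (h he)
  have := Submodule.finrank_mono this
  unfold grk
  omega

theorem grk_sub {V E : Type*} [Fintype V] [DecidableEq E] (tail head : E → V) (X Y : Finset E) :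
    grk tail head (X ∪ Y) + grk tail head (X ∩ Y) ≤ grk tail head X + grk tail head Y := by
  have h1 : constSub tail head (X ∪ Y) = constSub tail head X ⊓ constSub tail head Y := by
    ext φ
    simp only [mem_constSub, Submodule.mem_inf, Finset.mem_union]
    constructor
    · intro h; exact ⟨fun e he => h e (Or.inl he), fun e he => h e (Or.inr he)⟩
    · rintro ⟨h, h'⟩ e (he | he)
      · exact h e he
      · exact h' e he
  have h2 : constSub tail head X ⊔ constSub tail head Y ≤ constSub tail head (X ∩ Y) := by
    apply sup_le
    · intro φ hφ e he; exact hφ e (Finset.mem_inter.mp he).1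
    · intro φ hφ e he; exact hφ e (Finset.mem_inter.mp he).2
  have h3 := Submodule.finrank_sup_add_finrank_inf_eq (constSub tail head X)
    (constSub tail head Y)
  have h4 := Submodule.finrank_mono h2
  rw [← h1] at h3
  unfold grk
  omega

theorem grk_le_card {V E : Type*} [Fintype V] (tail head : E → V) (X : Finset E) :
    grk tail head X ≤ X.card := by
  let L : (V → ℚ) →ₗ[ℚ] (X → ℚ) :=
    { toFun := fun φ e => φ (tail e) - φ (head e)
      map_add' := by intro a b; ext e; simp; ring
      map_smul' := by intro c a; ext e; simp; ring }
  have hk : LinearMap.ker L = constSub tail head X := by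
    ext φ
    simp only [LinearMap.mem_ker, mem_constSub, funext_iff]
    constructor
    · intro h e he
      have := h ⟨e, he⟩
      simpa [L, sub_eq_zero] using this
    · intro h e
      simpa [L, sub_eq_zero] using h e e.2
  have h1 := LinearMap.finrank_range_add_finrank_ker L
  have h2 := Submodule.finrank_le (LinearMap.range L)
  rw [hk] at h1
  simp at h1 h2
  unfold grk
  omega

theorem grk_eq {V E : Type*} [Fintype V] [DecidableEq V] (tail head : E → V) (F : Finset E) :
    grk tail head F = ((incVerts tail head F).card : ℤ) - numComp tail head F := by
  classical
  set W := incVerts tail head F with hW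
  let r : {x : V // x ∈ W} → {x : V // x ∈ W} → Prop := fun u v => adjRel tail head F u.1 v.1
  have ht : ∀ e ∈ F, tail e ∈ W := fun e he =>
    Finset.mem_union_left _ (Finset.mem_image_of_mem _ he)
  have hh : ∀ e ∈ F, head e ∈ W := fun e he =>
    Finset.mem_union_right _ (Finset.mem_image_of_mem _ he)
  let L : constSub tail head F ≃ₗ[ℚ] (Quot r → ℚ) × ({x : V // x ∉ W} → ℚ) :=
    { toFun := fun φ => (Quot.lift (fun u => φ.1 u.1) (by
          rintro u v ⟨e, he, ⟨h1, h2⟩ | ⟨h1, h2⟩⟩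
          · rw [← h1, ← h2]; exact φ.2 e he
          · rw [← h1, ← h2]; exact (φ.2 e he).symm), fun x => φ.1 x.1)
      map_add' := by
        intro a b
        refine Prod.ext (funext fun q => ?_) (funext fun x => rfl)
        induction q using Quot.ind
        rfl
      map_smul' := by
        intro a b
        refine Prod.ext (funext fun q => ?_) (funext fun x => rfl)
        induction q using Quot.ind
        rfl
      invFun := fun p => ⟨fun v => if h : v ∈ W then p.1 (Quot.mk _ ⟨v, h⟩) else p.2 ⟨v, h⟩, by
        intro e he
        simp only [ht e he, hh e he, dif_pos]
        have hr : r ⟨tail e, ht e he⟩ ⟨head e, hh e he⟩ := ⟨e, he, Or.inl ⟨rfl, rfl⟩⟩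
        exact congrArg p.1 (Quot.sound hr)⟩
      left_inv := by
        intro φ
        ext v
        by_cases h : v ∈ W <;> simp [h]
      right_inv := by
        intro p
        refine Prod.ext (funext fun q => ?_) (funext fun x => ?_)
        · induction q using Quot.ind with
          | mk u => simp [u.2]
        · simp [x.2] }
  haveI : Fintype (Quot r) := Fintype.ofFinite _
  have h1 := L.finrank_eq
  rw [Module.finrank_prod, Module.finrank_pi, Module.finrank_pi] at h1
  have h2 : numComp tail head F = Fintype.card (Quot r) := Nat.card_eq_fintype_card
  have h3 : Fintype.card {x : V // x ∉ W} = Fintype.card V - W.card := by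
    rw [Fintype.card_subtype_compl]; simp
  have h4 : W.card ≤ Fintype.card V := Finset.card_le_univ W
  unfold grk
  omega

theorem one_mem_constSub {V E : Type*} (tail head : E → V) (F : Finset E) :
    (fun _ => 1) ∈ constSub tail head F := fun _ _ => rfl

theorem grk_le {V E : Type*} [Fintype V] [Nonempty V] (tail head : E → V) (F : Finset E) :
    grk tail head F ≤ Fintype.card V - 1 := by
  have : 0 < Module.finrank ℚ (constSub tail head F) := by
    rw [Module.finrank_pos_iff_exists_ne_zero]
    refine ⟨⟨_, one_mem_constSub tail head F⟩, fun h => ?_⟩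
    have := congrFun (congrArg Subtype.val h) (Classical.arbitrary V)
    simp at this
  unfold grk
  omega

theorem conn_of_grk {V E : Type*} [Fintype V] (tail head : E → V) (F : Finset E)
    (h : (Fintype.card V : ℤ) - 1 ≤ grk tail head F) (u v : V) :
    Relation.EqvGen (adjRel tail head F) u v := by
  classical
  have h1 : Module.finrank ℚ (constSub tail head F) ≤ 1 := by
    unfold grk at h; omega
  obtain ⟨w, hw⟩ := finrank_le_one_iff.mp h1
  obtain ⟨a, ha⟩ := hw ⟨_, one_mem_constSub tail head F⟩
  obtain ⟨b, hb⟩ := hw ⟨fun x => if Relation.EqvGen (adjRel tail head F) u x then 1 else 0, by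
    intro e he
    have hadj : Relation.EqvGen (adjRel tail head F) (tail e) (head e) :=
      Relation.EqvGen.rel _ _ ⟨e, he, Or.inl ⟨rfl, rfl⟩⟩
    have : Relation.EqvGen (adjRel tail head F) u (tail e) ↔
        Relation.EqvGen (adjRel tail head F) u (head e) :=
      ⟨fun h => h.trans _ _ _ hadj, fun h => h.trans _ _ _ hadj.symm⟩
    simp only [this]⟩
  have au := congrFun (congrArg Subtype.val ha) u
  have av := congrFun (congrArg Subtype.val ha) v
  have bu := congrFun (congrArg Subtype.val hb) u
  have bv := congrFun (congrArg Subtype.val hb) v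
  simp only [Submodule.coe_smul, Pi.smul_apply, smul_eq_mul] at au av bu bv
  rw [if_pos (Relation.EqvGen.refl u)] at bu
  by_contra hn
  rw [if_neg hn] at bv
  have ha0 : a ≠ 0 := by rintro rfl; simp at au
  have : w.1 u = w.1 v := mul_left_cancel₀ ha0 (au.trans av.symm)
  rw [this, bv] at bu
  norm_num at bu

theorem grk_of_conn {V E : Type*} [Fintype V] (tail head : E → V) (F : Finset E)
    (h : ∀ u v, Relation.EqvGen (adjRel tail head F) u v) :
    (Fintype.card V : ℤ) - 1 ≤ grk tail head F := by
  have h1 : Module.finrank ℚ (constSub tail head F) ≤ 1 := by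
    apply finrank_le_one (⟨_, one_mem_constSub tail head F⟩ : constSub tail head F)
    intro w
    rcases isEmpty_or_nonempty V with hV | ⟨⟨u⟩⟩
    · exact ⟨0, by ext v; exact hV.elim v⟩
    · refine ⟨w.1 u, ?_⟩
      ext v
      have : ∀ x y, Relation.EqvGen (adjRel tail head F) x y → w.1 x = w.1 y := by
        intro x y hxy
        induction hxy with
        | rel x y hxy =>
          obtain ⟨e, he, ⟨h1, h2⟩ | ⟨h1, h2⟩⟩ := hxy
          · rw [← h1, ← h2]; exact w.2 e he
          · rw [← h1, ← h2]; exact (w.2 e he).symm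
        | refl x => rfl
        | symm x y _ ih => exact ih.symm
        | trans x y z _ _ ih1 ih2 => exact ih1.trans ih2
      simpa using this u v (h u v)
  unfold grk
  omega

theorem tree_inter {V E : Type*} [Fintype V] [DecidableEq E] (tail head : E → V)
    (T F : Finset E) (hT : IsSpanningTree tail head T) :
    ((F ∩ T).card : ℤ) ≤ grk tail head F := by
  have h1 := grk_of_conn tail head T hT.2
  have h2 := grk_sub tail head (F ∩ T) (T \ F)
  have h3 : F ∩ T ∪ T \ F = T := by ext; simp; tauto
  have h4 : (F ∩ T) ∩ (T \ F) = ∅ := by ext; simp; tauto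
  rw [h3, h4, grk_empty] at h2
  have h5 := grk_le_card tail head (T \ F)
  have h6 := grk_mono tail head (F ∩ T) F Finset.inter_subset_left
  have h7 := Finset.card_inter_add_card_sdiff T F
  rw [Finset.inter_comm] at h7
  have h8 := hT.1
  omega

theorem incVerts_mono {V E : Type*} [DecidableEq V] (tail head : E → V) (X Y : Finset E)
    (h : X ⊆ Y) : incVerts tail head X ⊆ incVerts tail head Y :=
  Finset.union_subset_union (Finset.image_subset_image h) (Finset.image_subset_image h)

theorem incVerts_sub {V E : Type*} [DecidableEq V] [DecidableEq E] (tail head : E → V)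
    (X Y : Finset E) :
    (incVerts tail head (X ∪ Y)).card + (incVerts tail head (X ∩ Y)).card ≤
      (incVerts tail head X).card + (incVerts tail head Y).card := by
  have h1 : incVerts tail head (X ∪ Y) = incVerts tail head X ∪ incVerts tail head Y := by
    simp only [incVerts, Finset.image_union]
    ext; simp only [Finset.mem_union]; tauto
  have h2 : incVerts tail head (X ∩ Y) ⊆ incVerts tail head X ∩ incVerts tail head Y :=
    Finset.subset_inter (incVerts_mono _ _ _ _ Finset.inter_subset_left)
      (incVerts_mono _ _ _ _ Finset.inter_subset_right)
  have h3 := Finset.card_le_card h2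
  have h4 := Finset.card_union_add_card_inter (incVerts tail head X) (incVerts tail head Y)
  rw [h1]
  omega

theorem pseudo_inter {V E : Type*} [Fintype V] [DecidableEq V] [DecidableEq E] (tail head : E → V)
    (P F : Finset E) (hP : IsSpanningPseudoForest tail head P) (hF : F.Nonempty) :
    (F ∩ P).card ≤ (incVerts tail head F).card := by
  obtain ⟨e, he⟩ := hF
  have hne : (incVerts tail head F).Nonempty :=
    ⟨tail e, Finset.mem_union_left _ (Finset.mem_image_of_mem _ he)⟩
  refine le_trans (Finset.card_le_card ?_) (hP.2 _ hne)
  intro a ha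
  rw [Finset.mem_inter] at ha
  exact Finset.mem_filter.mpr ⟨ha.2, Finset.mem_union_left _ (Finset.mem_image_of_mem _ ha.1),
    Finset.mem_union_right _ (Finset.mem_image_of_mem _ ha.1)⟩

/-- The family of submodular functions to which the partition theorem is applied. -/
noncomputable def famFn {V E : Type*} [Fintype V] [DecidableEq V] [DecidableEq E]
    (tail head : E → V) (d c K : ℕ) : (Fin d ⊕ Fin c) ⊕ Unit → Finset E → ℤ
  | .inl (.inl _), F => grk tail head F
  | .inl (.inr _), F => (incVerts tail head F).card
  | .inr _, F => if F = ∅ then 0 else K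

theorem forward_part {V E : Type*} [Fintype V] [DecidableEq V] [Fintype E] [DecidableEq E]
    (tail head : E → V) (hn : 1 ≤ Fintype.card V) (d c K : ℕ)
    (hE : (Fintype.card E : ℤ) = d * (Fintype.card V - 1) + c * Fintype.card V + K)
    (h : ∀ F : Finset E, F.Nonempty → (F.card : ℤ) ≤
      d * grk tail head F + c * (incVerts tail head F).card + K) :
    ∃ (T : Fin d → Finset E) (P : Fin c → Finset E) (R : Finset E),
          (∀ i, IsSpanningTree tail head (T i)) ∧
          (∀ j, IsSpanningPseudoForest tail head (P j)) ∧
          R.card = K ∧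
          (∀ i i', i ≠ i' → Disjoint (T i) (T i')) ∧
          (∀ j j', j ≠ j' → Disjoint (P j) (P j')) ∧
          (∀ i j, Disjoint (T i) (P j)) ∧
          (∀ i, Disjoint (T i) R) ∧
          (∀ j, Disjoint (P j) R) ∧
          (Finset.univ.biUnion T ∪ Finset.univ.biUnion P ∪ R = Finset.univ) := by
  classical
  haveI : Nonempty V := Fintype.card_pos_iff.mp hn
  obtain ⟨col, hcol⟩ := rado_partition (famFn tail head d c K)
    (by rintro ((i | i) | i)
        · exact grk_empty _ _
        · simp [famFn, incVerts]
        · simp [famFn])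
    (by rintro ((i | i) | i) X Y hXY
        · exact grk_mono _ _ _ _ hXY
        · simp only [famFn]
          exact_mod_cast Finset.card_le_card (incVerts_mono _ _ _ _ hXY)
        · simp only [famFn]
          by_cases hY : Y = ∅
          · subst hY
            rw [Finset.subset_empty.mp hXY]
          · rw [if_neg hY]
            split_ifs <;> simp)
    (by rintro ((i | i) | i) X Y
        · exact grk_sub _ _ _ _
        · simp only [famFn]
          exact_mod_cast incVerts_sub tail head X Y
        · simp only [famFn]
          by_cases hX : X = ∅
          · subst hX; simp
          by_cases hY : Y = ∅
          · subst hY; simp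
          have : X ∪ Y ≠ ∅ := by
            intro h; exact hX (Finset.union_eq_empty.mp h).1
          rw [if_neg hX, if_neg hY, if_neg this]
          split_ifs <;> simp)
    (by intro F
        rcases F.eq_empty_or_nonempty with rfl | hF
        · simp [Fintype.sum_sum_type, famFn, grk_empty, incVerts]
        · have := h F hF
          simpa [Fintype.sum_sum_type, famFn, hF.ne_empty] using this)
  let cl : (Fin d ⊕ Fin c) ⊕ Unit → Finset E := fun i => Finset.univ.filter fun a => col a = i
  have hcl : ∀ i F, F ⊆ cl i → (F.card : ℤ) ≤ famFn tail head d c K i F := by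
    intro i F hF
    exact hcol i F fun a ha => (Finset.mem_filter.mp (hF ha)).2
  have hdisj : ∀ i j, i ≠ j → Disjoint (cl i) (cl j) := by
    intro i j hij
    rw [Finset.disjoint_left]
    intro a ha hb
    exact hij ((Finset.mem_filter.mp ha).2.symm.trans (Finset.mem_filter.mp hb).2)
  let bd : (Fin d ⊕ Fin c) ⊕ Unit → ℤ
    | .inl (.inl _) => Fintype.card V - 1
    | .inl (.inr _) => Fintype.card V
    | .inr _ => K
  have hbd : ∀ i, ((cl i).card : ℤ) ≤ bd i := by
    intro i
    refine (hcl i _ subset_rfl).trans ?_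
    rcases i with (i | i) | i
    · exact grk_le _ _ _
    · simp only [famFn, bd]
      exact_mod_cast Finset.card_le_univ _
    · simp only [famFn, bd]
      split_ifs <;> simp
  have hsum : ∑ i, ((cl i).card : ℤ) = ∑ i, bd i := by
    have h1 : ∑ i, (cl i).card = Fintype.card E :=
      (Finset.card_eq_sum_card_fiberwise (f := col) (s := Finset.univ) (t := Finset.univ)
        (by intro x _; simp)).symm
    have h2 : ∑ i, ((cl i).card : ℤ) = Fintype.card E := by exact_mod_cast h1
    rw [h2, hE]
    simp [Fintype.sum_sum_type, bd]
    ring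
  have heq : ∀ i, ((cl i).card : ℤ) = bd i := by
    intro i
    exact (Finset.sum_eq_sum_iff_of_le (fun i _ => hbd i)).mp hsum i (Finset.mem_univ _)
  refine ⟨fun i => cl (.inl (.inl i)), fun j => cl (.inl (.inr j)), cl (.inr ()),
    ?_, ?_, ?_, ?_, ?_, ?_, ?_, ?_, ?_⟩
  · intro i
    have h1 := heq (.inl (.inl i))
    have h2 := hcl (.inl (.inl i)) _ subset_rfl
    simp only [bd, famFn] at h1 h2
    refine ⟨by dsimp only; omega, conn_of_grk _ _ _ (h1 ▸ h2)⟩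
  · intro j
    have h1 := heq (.inl (.inr j))
    simp only [bd] at h1
    refine ⟨by exact_mod_cast h1, fun U _ => ?_⟩
    have h2 := hcl (.inl (.inr j)) ((cl (.inl (.inr j))).filter
      fun e => tail e ∈ U ∧ head e ∈ U) (Finset.filter_subset _ _)
    simp only [famFn] at h2
    refine le_trans (by exact_mod_cast h2) (Finset.card_le_card ?_)
    intro v hv
    simp only [incVerts, Finset.mem_union, Finset.mem_image, Finset.mem_filter] at hv
    rcases hv with ⟨e, he, rfl⟩ | ⟨e, he, rfl⟩
    · exact he.2.1
    · exact he.2.2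
  · have h1 := heq (.inr ())
    simp only [bd] at h1
    exact_mod_cast h1
  · intro i i' hii; exact hdisj _ _ (by simpa using hii)
  · intro i i' hii; exact hdisj _ _ (by simpa using hii)
  · intro i j; exact hdisj _ _ (by simp)
  · intro i; exact hdisj _ _ (by simp)
  · intro i; exact hdisj _ _ (by simp)
  · ext a
    simp only [Finset.mem_union, Finset.mem_biUnion, Finset.mem_univ, true_and, iff_true]
    have ha : a ∈ cl (col a) := by simp [cl]
    rcases hca : col a with (i | i) | i <;> rw [hca] at ha
    · exact Or.inl (Or.inl ⟨i, ha⟩)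
    · exact Or.inl (Or.inr ⟨i, ha⟩)
    · exact Or.inr ha

/-- bases of the union of `d` graphic matroids, `C(d,2)` bicycle
matroids and the uniform matroid of rank `C(d+1,2)`.  With
`|E| = C(d+1,2)(n−1) + d²`, the count `|F| ≤ d(n_F − ω_F) + C(d,2)·n_F + C(d+1,2)` holds
for every nonempty `F ⊆ E` iff `E` partitions into `d` edge-disjoint spanning trees,
`C(d,2)` edge-disjoint spanning pseudo-forests, and a remaining set of `C(d+1,2)`
edges. -/
theorem stmt_18 {d : ℕ} (hd : 1 ≤ d) {V E : Type*} [Fintype V] [DecidableEq V]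
    [Fintype E] [DecidableEq E] (tail head : E → V) (hn : 1 ≤ Fintype.card V)
    (hE : Fintype.card E + (d + 1).choose 2 =
      (d + 1).choose 2 * Fintype.card V + d ^ 2) :
    (∀ F : Finset E, F.Nonempty →
        (F.card : ℤ) ≤
          (d : ℤ) * ((incVerts tail head F).card - numComp tail head F)
            + (d.choose 2 : ℤ) * (incVerts tail head F).card + ((d + 1).choose 2 : ℤ))
      ↔ ∃ (T : Fin d → Finset E) (P : Fin (d.choose 2) → Finset E) (R : Finset E),
          (∀ i, IsSpanningTree tail head (T i)) ∧
          (∀ j, IsSpanningPseudoForest tail head (P j)) ∧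
          R.card = (d + 1).choose 2 ∧
          (∀ i i', i ≠ i' → Disjoint (T i) (T i')) ∧
          (∀ j j', j ≠ j' → Disjoint (P j) (P j')) ∧
          (∀ i j, Disjoint (T i) (P j)) ∧
          (∀ i, Disjoint (T i) R) ∧
          (∀ j, Disjoint (P j) R) ∧
          (Finset.univ.biUnion T ∪ Finset.univ.biUnion P ∪ R = Finset.univ) := by
  have hch : (d + 1).choose 2 = d + d.choose 2 := by
    rw [Nat.choose_succ_succ' d 1]; simp
  have hsq : (d : ℤ) ^ 2 = d + 2 * (d.choose 2 : ℕ) := by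
    have h3 : (d + 1).choose 2 * 2 = (d + 1) * d := by
      have h4 := Nat.add_one_mul_choose_eq d 1
      simp at h4
      linarith
    rw [hch] at h3
    have h5 : ((d : ℤ) + (d.choose 2 : ℕ)) * 2 = (d + 1) * d := by exact_mod_cast h3
    linarith
  have hEz : (Fintype.card E : ℤ) =
      d * (Fintype.card V - 1) + (d.choose 2 : ℕ) * Fintype.card V + ((d + 1).choose 2 : ℕ) := by
    have h1 : (Fintype.card E : ℤ) + ((d + 1).choose 2 : ℕ) =
      ((d + 1).choose 2 : ℕ) * Fintype.card V + d ^ 2 := by exact_mod_cast hE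
    rw [hch] at h1 ⊢
    push_cast at h1 ⊢
    linarith
  constructor
  · intro h
    refine forward_part tail head hn d (d.choose 2) ((d + 1).choose 2) hEz ?_
    intro F hF
    rw [grk_eq]
    exact h F hF
  · rintro ⟨T, P, R, hT, hP, hR, -, -, -, -, -, hU⟩ F hF
    rw [← grk_eq]
    have hFU : F = (Finset.univ.biUnion fun i => F ∩ T i) ∪
        (Finset.univ.biUnion fun j => F ∩ P j) ∪ (F ∩ R) := by
      rw [← Finset.inter_biUnion, ← Finset.inter_biUnion, ← Finset.inter_union_distrib_left,
        ← Finset.inter_union_distrib_left, hU, Finset.inter_univ]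
    have h1 : F.card ≤ ∑ i, (F ∩ T i).card + ∑ j, (F ∩ P j).card + (F ∩ R).card := by
      conv_lhs => rw [hFU]
      refine (Finset.card_union_le _ _).trans (Nat.add_le_add_right ?_ _)
      refine (Finset.card_union_le _ _).trans (Nat.add_le_add ?_ ?_)
      · exact Finset.card_biUnion_le
      · exact Finset.card_biUnion_le
    have h1z : (F.card : ℤ) ≤ ∑ i, ((F ∩ T i).card : ℤ) + ∑ j, ((F ∩ P j).card : ℤ)
        + (F ∩ R).card := by exact_mod_cast h1
    have h2 : ∑ i, ((F ∩ T i).card : ℤ) ≤ d * grk tail head F := by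
      refine (Finset.sum_le_sum fun i _ => tree_inter tail head (T i) F (hT i)).trans ?_
      simp
    have h3 : ∑ j, ((F ∩ P j).card : ℤ) ≤ (d.choose 2 : ℕ) * (incVerts tail head F).card := by
      refine (Finset.sum_le_sum (g := fun _ => ((incVerts tail head F).card : ℤ))
        fun j _ => ?_).trans ?_
      · exact_mod_cast pseudo_inter tail head (P j) F (hP j) hF
      · simp
    have h4 : ((F ∩ R).card : ℤ) ≤ ((d + 1).choose 2 : ℕ) := by
      rw [← hR]; exact_mod_cast Finset.card_le_card Finset.inter_subset_right
    linarith
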